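/- There exists a polynomial q with natural-number coefficients such that for every natural number k ≥ 0 there exists a bipartite graph (L, R, E) where: L is the set of all binary strings of length at least k; R is a finite set of cardinality strictly less than 2^(k+1); every vertex x ∈ L has degree at most q(|x|), where the polynomial q does not depend on k; and (L, R, E) admits online matchings up to size 2^k. -/

import Mathlib

/-- The set of neighbors of a set `S` of left vertices in the bipartite graph
with edge relation `E`. -/
def nbhd {α β : Type*} (E : Set (α × β)) (S : Set α) : Set β :=
  {y | ∃ x ∈ S, (x, y) ∈ E}

/-- A bipartite graph with left vertices `L` and edge relation `E` admits online
matchings up to size `s` if there is a strategy `g`, mapping each finite sequence of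
pairwise distinct left vertices to a right vertex, such that for every sequence
`x₁, …, x_m` of pairwise distinct elements of `L` with `m ≤ s`, setting
`y_j = g(x₁, …, x_j)`, every `y_j` is a neighbor of `x_j` and the `y_j` are pairwise
distinct. -/
def AdmitsOnlineMatching {α β : Type*} (L : Set α) (E : Set (α × β)) (s : ℕ) : Prop :=
  ∃ g : List α → β,
    ∀ xs : List α, xs.Nodup → (∀ x ∈ xs, x ∈ L) → xs.length ≤ s →
      (∀ i : Fin xs.length, (xs.get i, g (xs.take (i + 1))) ∈ E) ∧
      (∀ i j : Fin xs.length, i ≠ j → g (xs.take (i + 1)) ≠ g (xs.take (j + 1)))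

/-- All requests can be served for `n` more rounds. -/
def Win {α β : Type*} [DecidableEq α] [DecidableEq β] (N : α → Finset β) :
    ℕ → Finset α → Finset β → Prop
  | 0, _, _ => True
  | n + 1, A, U => ∀ x, x ∉ A → ∃ y ∈ N x, y ∉ U ∧ Win N n (insert x A) (insert y U)

theorem win_strategy {α β : Type*} [DecidableEq α] [DecidableEq β] [Nonempty β]
    (N : α → Finset β) (n : ℕ) : ∀ (A : Finset α) (U : Finset β), Win N n A U →
    ∃ g : List α → β, ∀ xs : List α, xs.Nodup → (∀ x ∈ xs, x ∉ A) → xs.length ≤ n →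
      (∀ i : Fin xs.length, g (xs.take (i + 1)) ∈ N (xs.get i) ∧ g (xs.take (i + 1)) ∉ U) ∧
      (∀ i j : Fin xs.length, i ≠ j → g (xs.take (i + 1)) ≠ g (xs.take (j + 1))) := by
  induction n with
  | zero =>
    intro A U _
    refine ⟨fun _ => Classical.arbitrary β, ?_⟩
    intro xs _ _ hl
    have : xs = [] := List.length_eq_zero_iff.mp (by omega)
    subst this
    exact ⟨fun i => i.elim0, fun i => i.elim0⟩
  | succ n ih =>
    intro A U hW
    have h1 : ∀ x, ∃ (y : β) (g : List α → β), x ∉ A → (y ∈ N x ∧ y ∉ U ∧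
        ∀ xs : List α, xs.Nodup → (∀ z ∈ xs, z ∉ insert x A) → xs.length ≤ n →
      (∀ i : Fin xs.length, g (xs.take (i + 1)) ∈ N (xs.get i) ∧
        g (xs.take (i + 1)) ∉ insert y U) ∧
      (∀ i j : Fin xs.length, i ≠ j → g (xs.take (i + 1)) ≠ g (xs.take (j + 1)))) := by
      intro x
      by_cases hx : x ∈ A
      · exact ⟨Classical.arbitrary β, fun _ => Classical.arbitrary β, fun h => absurd hx h⟩
      · obtain ⟨y, hy, hyU, hw⟩ := hW x hx
        obtain ⟨g, hg⟩ := ih _ _ hw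
        exact ⟨y, g, fun _ => ⟨hy, hyU, hg⟩⟩
    choose y g h using h1
    refine ⟨fun l => match l with
      | [] => Classical.arbitrary β
      | [x] => y x
      | x :: z :: l => g x (z :: l), ?_⟩
    intro xs hnd hA hl
    cases xs with
    | nil => exact ⟨fun i => i.elim0, fun i => i.elim0⟩
    | cons x xs =>
      obtain ⟨hy, hyU, hg⟩ := h x (hA x (by simp))
      rw [List.nodup_cons] at hnd
      obtain ⟨hg1, hg2⟩ := hg xs hnd.2 (by
        intro z hz
        rw [Finset.mem_insert]
        rintro (rfl | hzA)
        · exact hnd.1 hz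
        · exact hA z (by simp [hz]) hzA) (by simpa using hl)
      have key : ∀ i : Fin xs.length, (match (x :: xs).take (i + 1 + 1) with
          | [] => Classical.arbitrary β
          | [x] => y x
          | x :: z :: l => g x (z :: l)) = g x (xs.take (i + 1)) := by
        intro i
        cases xs with
        | nil => exact i.elim0
        | cons z l => simp
      constructor
      · intro i
        refine Fin.cases ?_ (fun i => ?_) i
        · simpa using ⟨hy, hyU⟩
        · have h3 := hg1 i
          rw [Finset.mem_insert, not_or] at h3
          have := key i
          simp only [Fin.val_succ]
          rw [this]
          exact ⟨h3.1, h3.2.2⟩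
      · intro i j
        refine Fin.cases ?_ (fun i => ?_) i <;> refine Fin.cases ?_ (fun j => ?_) j
        · intro h; exact absurd rfl h
        · intro _
          simp only [Fin.val_succ]
          rw [key j]
          have h3 := (hg1 j).2
          rw [Finset.mem_insert, not_or] at h3
          simpa using fun h => h3.1 h.symm
        · intro _
          simp only [Fin.val_succ]
          rw [key i]
          have h3 := (hg1 i).2
          rw [Finset.mem_insert, not_or] at h3
          simpa using h3.1
        · intro hij
          simp only [Fin.val_succ]
          rw [key i, key j]
          exact hg2 i j (fun h => hij (by rw [h]))

theorem win_compose {α β γ : Type*} [DecidableEq α] [DecidableEq β] [DecidableEq γ]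
    (N1 : α → Finset β) (N2 : α → Finset γ) (s : ℕ)
    (hN2 : ∀ S : Finset α, S.card = s → s < (S.biUnion N2).card) (n : ℕ) :
    ∀ (n1 : ℕ) (A F : Finset α) (U1 : Finset β) (U2 : Finset γ), Win N1 n1 F U1 → F ⊆ A →
      F.card + n1 = s → U2.card + F.card + n = 2 * s → (∀ x ∈ F, N2 x ⊆ U2) →
      Win (fun x => (N1 x).disjSum (N2 x)) n A (U1.disjSum U2) := by
  induction n with
  | zero => intros; trivial
  | succ n ih =>
    intro n1 A F U1 U2 hW hFA hF hU hN x hx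
    by_cases hfree : N2 x ⊆ U2
    · cases n1 with
      | zero =>
        have h1 := hN2 F (by omega)
        have h2 : (F.biUnion N2).card ≤ U2.card :=
          Finset.card_le_card (Finset.biUnion_subset.mpr hN)
        omega
      | succ m =>
        have hxF : x ∉ F := fun h => hx (hFA h)
        obtain ⟨y, hy, hyU, hw⟩ := hW x hxF
        refine ⟨Sum.inl y, by simpa using hy, by simpa using hyU, ?_⟩
        have := ih m (insert x A) (insert x F) (insert y U1) U2 hw
          (Finset.insert_subset_insert _ hFA)
          (by rw [Finset.card_insert_of_notMem hxF]; omega)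
          (by rw [Finset.card_insert_of_notMem hxF]; omega)
          (by
            intro z hz
            rcases Finset.mem_insert.mp hz with rfl | hz
            · exact hfree
            · exact hN z hz)
        convert this using 1
        ext z; cases z <;> simp
    · obtain ⟨y, hy, hyU⟩ := Finset.not_subset.mp hfree
      refine ⟨Sum.inr y, by simpa using hy, by simpa using hyU, ?_⟩
      have := ih n1 (insert x A) F U1 (insert y U2) hW
        (hFA.trans (Finset.subset_insert _ _)) hF
        (by rw [Finset.card_insert_of_notMem hyU]; omega)
        (fun z hz => (hN z hz).trans (Finset.subset_insert _ _))
      convert this using 1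
      ext z; cases z <;> simp

theorem exists_half {γ : Type*} [Fintype γ] [DecidableEq γ] (h : ℕ) (hh : 0 < h)
    (hc : Fintype.card γ = 2 * h) (F : Finset (Finset γ)) (hF : ∀ T ∈ F, T.card = h)
    (a : Finset γ → ℝ) :
    ∃ y : γ, ∑ T ∈ F with y ∈ T, a T ≤ (1 / 2) * ∑ T ∈ F, a T := by
  by_contra! hcon
  have h1 : ∑ y : γ, (1 / 2) * ∑ T ∈ F, a T < ∑ y : γ, ∑ T ∈ F with y ∈ T, a T := by
    apply Finset.sum_lt_sum_of_nonempty
    · rw [← Finset.card_pos, Finset.card_univ]; omega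
    · intro y _; exact hcon y
  have h2 : ∑ y : γ, ∑ T ∈ F with y ∈ T, a T = h * ∑ T ∈ F, a T := by
    simp_rw [Finset.sum_filter]
    rw [Finset.sum_comm, Finset.mul_sum]
    refine Finset.sum_congr rfl fun T hT => ?_
    rw [← Finset.sum_filter]
    simp [hF T hT]
  rw [h2, Finset.sum_const, Finset.card_univ, hc, nsmul_eq_mul] at h1
  push_cast at h1
  linarith

theorem exists_nbrs {γ : Type*} [Fintype γ] [DecidableEq γ] (h : ℕ) (hh : 0 < h)
    (hc : Fintype.card γ = 2 * h) (a : Finset γ → ℝ) (D : ℕ) :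
    ∀ (F : Finset (Finset γ)), (∀ T ∈ F, T.card = h) →
    ∃ N : Finset γ, N.card ≤ D ∧
      ∑ T ∈ F with N ⊆ T, a T ≤ (1 / 2) ^ D * ∑ T ∈ F, a T := by
  induction D with
  | zero => intro F _; exact ⟨∅, by simp, by simp⟩
  | succ D ih =>
    intro F hF
    obtain ⟨y, hy⟩ := exists_half h hh hc F hF a
    obtain ⟨N, hN, hs⟩ := ih (F.filter (fun T => y ∈ T))
      (fun T hT => hF T (Finset.mem_filter.mp hT).1)
    refine ⟨insert y N, (Finset.card_insert_le _ _).trans (by omega), ?_⟩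
    rw [Finset.filter_filter] at hs
    simp_rw [Finset.insert_subset_iff]
    refine hs.trans ?_
    rw [pow_succ, mul_assoc]
    exact mul_le_mul_of_nonneg_left hy (by positivity)

theorem exists_graph {α γ : Type*} [DecidableEq α] [Fintype γ] [DecidableEq γ] (h : ℕ)
    (hh : 0 < h) (hc : Fintype.card γ = 2 * h) (D : α → ℕ) (A : Finset α) :
    ∃ N : α → Finset γ, (∀ x ∈ A, (N x).card ≤ D x) ∧ (∀ x, x ∉ A → N x = Finset.univ) ∧
      ∑ T ∈ (Finset.univ : Finset γ).powersetCard h,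
        ∏ x ∈ A, (1 + 7 * (if N x ⊆ T then (1 : ℝ) else 0)) ≤
      4 ^ h * ∏ x ∈ A, (1 + 7 * (1 / 2 : ℝ) ^ D x) := by
  induction A using Finset.induction_on with
  | empty =>
    refine ⟨fun _ => Finset.univ, by simp, by simp, ?_⟩
    simp only [Finset.prod_empty, Finset.sum_const, Finset.card_powersetCard, Finset.card_univ,
      hc, nsmul_eq_mul, mul_one]
    have : (2 * h).choose h ≤ 2 ^ (2 * h) := Nat.choose_le_two_pow _ _
    rw [pow_mul] at this
    norm_num at this
    exact_mod_cast this
  | insert x A hx ih =>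
    obtain ⟨N, h1, h2, h3⟩ := ih
    set a : Finset γ → ℝ := fun T => ∏ x ∈ A, (1 + 7 * (if N x ⊆ T then (1 : ℝ) else 0)) with ha
    obtain ⟨M, hM, hs⟩ := exists_nbrs h hh hc a (D x)
      ((Finset.univ : Finset γ).powersetCard h) (fun T hT => (Finset.mem_powersetCard.mp hT).2)
    refine ⟨Function.update N x M, ?_, ?_, ?_⟩
    · intro z hz
      by_cases hzx : z = x
      · subst hzx; simpa using hM
      · rw [Function.update_of_ne hzx]
        exact h1 z ((Finset.mem_insert.mp hz).resolve_left hzx)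
    · intro z hz
      rw [Finset.mem_insert, not_or] at hz
      rw [Function.update_of_ne hz.1]
      exact h2 z hz.2
    · have h4 : ∀ T : Finset γ, ∏ z ∈ insert x A,
          (1 + 7 * (if Function.update N x M z ⊆ T then (1 : ℝ) else 0)) =
          a T + 7 * (if M ⊆ T then a T else 0) := by
        intro T
        rw [Finset.prod_insert hx, Function.update_self]
        have : ∏ z ∈ A, (1 + 7 * (if Function.update N x M z ⊆ T then (1 : ℝ) else 0)) = a T := by
          refine Finset.prod_congr rfl fun z hz => ?_
          rw [Function.update_of_ne (ne_of_mem_of_not_mem hz hx)]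
        rw [this]
        split_ifs <;> ring
      simp_rw [h4]
      rw [Finset.sum_add_distrib, ← Finset.mul_sum, ← Finset.sum_filter, Finset.prod_insert hx]
      have h5 : (0 : ℝ) ≤ 1 + 7 * (1 / 2) ^ D x := by positivity
      have h6 := mul_le_mul_of_nonneg_left h3 h5
      linarith

theorem prod_bound (A : Finset (List Bool)) (M : ℕ) (hA : ∀ x ∈ A, x.length < M) :
    ∏ x ∈ A, (1 + 7 * (1 / 2 : ℝ) ^ (2 * x.length + 5)) < 2 := by
  have hcard : ∀ n, (A.filter (fun x => x.length = n)).card ≤ 2 ^ n := by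
    intro n
    have h1 : A.filter (fun x => x.length = n) ⊆
        (Finset.univ : Finset (Fin n → Bool)).image List.ofFn := by
      intro x hx
      rw [Finset.mem_filter] at hx
      obtain ⟨_, rfl⟩ := hx
      exact Finset.mem_image.mpr ⟨x.get, Finset.mem_univ _, List.ofFn_get x⟩
    refine (Finset.card_le_card h1).trans (Finset.card_image_le.trans ?_)
    simp
  have hsum : ∑ x ∈ A, 7 * (1 / 2 : ℝ) ^ (2 * x.length + 5) ≤ 1 / 2 := by
    rw [← Finset.sum_fiberwise_of_maps_to (t := Finset.range M) (g := List.length)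
      (fun x hx => Finset.mem_range.mpr (hA x hx))]
    have h1 : ∀ n ∈ Finset.range M, ∑ x ∈ A with x.length = n,
        7 * (1 / 2 : ℝ) ^ (2 * x.length + 5) ≤ 7 / 32 * (1 / 2) ^ n := by
      intro n _
      have h2 : ∑ x ∈ A with x.length = n, 7 * (1 / 2 : ℝ) ^ (2 * x.length + 5) =
          ∑ x ∈ A with x.length = n, 7 * (1 / 2 : ℝ) ^ (2 * n + 5) := by
        refine Finset.sum_congr rfl fun x hx => ?_
        rw [(Finset.mem_filter.mp hx).2]
      rw [h2, Finset.sum_const, nsmul_eq_mul]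
      have h3 : ((A.filter (fun x => x.length = n)).card : ℝ) ≤ 2 ^ n := by
        exact_mod_cast hcard n
      refine (mul_le_mul_of_nonneg_right h3 (by positivity)).trans (le_of_eq ?_)
      have h4 : (2 : ℝ) ^ n * (1 / 2) ^ n = 1 := by rw [← mul_pow]; norm_num
      calc (2 : ℝ) ^ n * (7 * (1 / 2) ^ (2 * n + 5))
          = (2 ^ n * (1 / 2) ^ n) * (7 / 32 * (1 / 2) ^ n) := by ring
        _ = _ := by rw [h4, one_mul]
    refine (Finset.sum_le_sum h1).trans ?_
    rw [← Finset.mul_sum, geom_sum_eq (by norm_num)]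
    have : (0 : ℝ) ≤ (1 / 2) ^ M := by positivity
    have h5 : (((1 / 2 : ℝ)) ^ M - 1) / (1 / 2 - 1) = 2 - 2 * (1 / 2) ^ M := by ring
    rw [h5]
    linarith
  have h1 : ∏ x ∈ A, (1 + 7 * (1 / 2 : ℝ) ^ (2 * x.length + 5)) ≤
      Real.exp (∑ x ∈ A, 7 * (1 / 2 : ℝ) ^ (2 * x.length + 5)) := by
    rw [Real.exp_sum]
    refine Finset.prod_le_prod (fun _ _ => by positivity) fun x _ => ?_
    rw [add_comm]
    exact Real.add_one_le_exp _
  refine (h1.trans (Real.exp_le_exp.mpr hsum)).trans_lt ?_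
  have h2 := Real.exp_one_lt_d9
  have h3 : Real.exp (1 / 2) * Real.exp (1 / 2) = Real.exp 1 := by
    rw [← Real.exp_add]; norm_num
  nlinarith [Real.exp_pos (1 / 2)]

theorem exists_expander (h : ℕ) (hh : 0 < h) :
    ∃ N : List Bool → Finset (Fin (2 * h)), (∀ x, (N x).card ≤ 2 * x.length + 5) ∧
      ∀ S : Finset (List Bool), S.card = h → h < (S.biUnion N).card := by
  have hfin : {x : List Bool | x.length < 2 * h}.Finite := List.finite_length_lt Bool (2 * h)
  set A := hfin.toFinset with hAdef
  have hA : ∀ x, x ∈ A ↔ x.length < 2 * h := by intro x; simp [A]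
  obtain ⟨N, h1, h2, h3⟩ := exists_graph (γ := Fin (2 * h)) h hh (by simp)
    (fun x : List Bool => 2 * x.length + 5) A
  refine ⟨N, ?_, ?_⟩
  · intro x
    by_cases hx : x ∈ A
    · exact h1 x hx
    · rw [h2 x hx]
      rw [hA] at hx
      simp
      omega
  · intro S hS
    by_contra! hcon
    have hSA : S ⊆ A := by
      intro x hx
      by_contra hxA
      have h4 : N x ⊆ S.biUnion N := Finset.subset_biUnion_of_mem N hx
      have h5 := Finset.card_le_card h4
      rw [h2 x hxA] at h5
      simp at h5
      omega
    obtain ⟨T, hT, hTc⟩ := Finset.exists_superset_card_eq hcon (by simp; omega)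
    have h4 : (8 : ℝ) ^ h ≤ ∏ x ∈ A, (1 + 7 * (if N x ⊆ T then (1 : ℝ) else 0)) := by
      calc (8 : ℝ) ^ h = ∏ x ∈ S, (1 + 7 * (if N x ⊆ T then (1 : ℝ) else 0)) := by
            have h12 : (8 : ℝ) ^ h = ∏ x ∈ S, 8 := by rw [Finset.prod_const, hS]
            rw [h12]
            refine Finset.prod_congr rfl fun x hx => ?_
            rw [if_pos ((Finset.subset_biUnion_of_mem N hx).trans hT)]
            norm_num
        _ ≤ _ := by
            rw [← Finset.prod_sdiff hSA]
            refine le_mul_of_one_le_left ?_ ?_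
            · refine Finset.prod_nonneg fun x _ => ?_
              split_ifs <;> norm_num
            · refine (Finset.prod_const_one (s := A \ S)).symm.le.trans
                (Finset.prod_le_prod (fun _ _ => zero_le_one) fun x _ => ?_)
              split_ifs <;> norm_num
    have h5 : ∏ x ∈ A, (1 + 7 * (if N x ⊆ T then (1 : ℝ) else 0)) ≤
        ∑ T ∈ (Finset.univ : Finset (Fin (2 * h))).powersetCard h,
        ∏ x ∈ A, (1 + 7 * (if N x ⊆ T then (1 : ℝ) else 0)) := by
      refine Finset.single_le_sum
        (f := fun T => ∏ x ∈ A, (1 + 7 * (if N x ⊆ T then (1 : ℝ) else 0))) ?_ ?_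
      · intro T _
        refine Finset.prod_nonneg fun x _ => ?_
        split_ifs <;> norm_num
      · exact Finset.mem_powersetCard.mpr ⟨Finset.subset_univ _, hTc⟩
    have h6 := prod_bound A (2 * h) (fun x hx => (hA x).mp hx)
    have h7 : (8 : ℝ) ^ h = 4 ^ h * 2 ^ h := by rw [← mul_pow]; norm_num
    have h8 : (2 : ℝ) ≤ 2 ^ h := by
      calc (2 : ℝ) = 2 ^ 1 := by norm_num
        _ ≤ 2 ^ h := pow_le_pow_right₀ (by norm_num) hh
    have h9 : (0 : ℝ) < 4 ^ h := by positivity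
    have h10 := h4.trans (h5.trans h3)
    rw [h7] at h10
    have h11 := le_of_mul_le_mul_left h10 h9
    linarith

theorem exists_level (k : ℕ) : ∃ (β : Type) (_ : Fintype β) (_ : DecidableEq β)
    (N : List Bool → Finset β), Nonempty β ∧ Fintype.card β + 1 = 2 ^ (k + 1) ∧
      (∀ x, (N x).card ≤ (k + 1) * (2 * x.length + 5)) ∧ Win N (2 ^ k) ∅ ∅ := by
  induction k with
  | zero =>
    refine ⟨Unit, inferInstance, inferInstance, fun _ => Finset.univ, ⟨()⟩, by simp, ?_, ?_⟩
    · intro x; simp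
    · intro x _
      exact ⟨(), by simp, by simp, trivial⟩
  | succ k ih =>
    obtain ⟨β, _, _, N1, hne, hc, hd, hW⟩ := ih
    obtain ⟨N2, hd2, hN2⟩ := exists_expander (2 ^ k) (by positivity)
    refine ⟨β ⊕ Fin (2 * 2 ^ k), inferInstance, inferInstance,
      fun x => (N1 x).disjSum (N2 x), inferInstance, ?_, ?_, ?_⟩
    · rw [Fintype.card_sum, Fintype.card_fin]
      rw [pow_succ] at hc ⊢
      rw [pow_succ]
      omega
    · intro x
      rw [Finset.card_disjSum]
      have := hd x
      have := hd2 x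
      rw [add_mul (k + 1) 1]
      omega
    · have := win_compose N1 N2 (2 ^ k) hN2 (2 ^ (k + 1)) (2 ^ k) ∅ ∅ ∅ ∅ hW (by simp) (by simp)
        (by simp [pow_succ, mul_comm]) (by simp)
      simpa using this

/-- Online Matching Theorem, combinatorial content: there exists a
polynomial `q` with natural coefficients such that for every `k ≥ 0` there is a
bipartite graph `(L, R, E)` where `L` is the set of binary strings of length at
least `k`, `|R| < 2^(k+1)`, every `x ∈ L` has degree at most `q(|x|)` (with `q`
independent of `k`), and the graph admits online matchings up to size `2^k`. -/
theorem stmt_10 :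
    ∃ q : Polynomial ℕ, ∀ k : ℕ,
      ∃ (β : Type) (R : Set β) (E : Set (List Bool × β)),
        R.Finite ∧ R.ncard < 2 ^ (k + 1) ∧
        (∀ p ∈ E, k ≤ p.1.length ∧ p.2 ∈ R) ∧
        (∀ x : List Bool, k ≤ x.length → (nbhd E {x}).ncard ≤ q.eval x.length) ∧
        AdmitsOnlineMatching {x : List Bool | k ≤ x.length} E (2 ^ k) := by
  refine ⟨(Polynomial.X + 1) * (2 * Polynomial.X + 5), fun k => ?_⟩
  obtain ⟨β, _, _, N, hne, hc, hd, hW⟩ := exists_level k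
  refine ⟨β, Set.univ, {p | k ≤ p.1.length ∧ p.2 ∈ N p.1}, Set.finite_univ, ?_, ?_, ?_, ?_⟩
  · rw [Set.ncard_univ, Nat.card_eq_fintype_card]
    omega
  · intro p hp
    exact ⟨hp.1, trivial⟩
  · intro x hx
    have h1 : nbhd {p : List Bool × β | k ≤ p.1.length ∧ p.2 ∈ N p.1} {x} = ↑(N x) := by
      ext y
      simp [nbhd, hx]
    rw [h1, Set.ncard_coe_finset]
    refine (hd x).trans ?_
    simp only [Polynomial.eval_mul, Polynomial.eval_add, Polynomial.eval_X, Polynomial.eval_one,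
      Polynomial.eval_ofNat]
    exact Nat.mul_le_mul_right _ (by omega)
  · obtain ⟨g, hg⟩ := win_strategy N (2 ^ k) ∅ ∅ hW
    refine ⟨g, fun xs hnd hL hl => ?_⟩
    obtain ⟨h1, h2⟩ := hg xs hnd (by simp) hl
    exact ⟨fun i => ⟨hL _ (List.get_mem xs i), (h1 i).1⟩, h2⟩
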